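/- For every integer n with n ≤ a − 1, there is an isomorphism of R-modules H^n(T, D) ≅ H^n(P, D). Since P is strictly two-periodic, H^n(P, D) depends only on the parity of n; thus the stable values of the cohomology of the totalization in large negative even (respectively odd) degrees are computed by H^0 (respectively H^1) of the folded two-periodic complex. (This is the paper's identification, for n ≫ 0, of ℋ^0 and ℋ^1 of the folded matrix-factorization complex Ξ(dδ_X^*E) with the stable Tor-sheaves Tor_{2n}(Δ_X, E) and Tor_{2n+1}(Δ_X, E), in the trivialized affine model.) -/

import Mathlib

open DirectSum

set_option synthInstance.maxHeartbeats 1000000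
set_option maxHeartbeats 1000000

/-- Cast of a `ℤ`-indexed family of modules along an equality of indices. -/
def lcast (R : Type) [CommRing R] (C : ℤ → Type) [∀ j, AddCommGroup (C j)]
    [∀ j, Module R (C j)] {j j' : ℤ} (e : j = j') : C j →ₗ[R] C j' := by
  subst e; exact LinearMap.id

/-- The totalization `T^n = ⊕_{i ≥ 0} M^{n+2i}`. -/
abbrev Ttot (M : ℤ → Type) [∀ j, AddCommGroup (M j)] (n : ℤ) : Type :=
  ⨁ (i : ℕ), M (n + 2 * (i : ℤ))

/-- The folded object `P^n = ⊕_{i ∈ ℤ} M^{n+2i}`. -/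
abbrev Ptot (M : ℤ → Type) [∀ j, AddCommGroup (M j)] (n : ℤ) : Type :=
  ⨁ (i : ℤ), M (n + 2 * i)

/-- The degree-one map `D = d + h` on the totalization `T`:  out of the summand
`M^{n+2i}` it is the sum of `d` (landing in summand `i`) and `h` (landing in
summand `i - 1`; for `i = 0` there is no such summand and the `h`-component is zero). -/
noncomputable def DT (R : Type) [CommRing R] (M : ℤ → Type) [∀ j, AddCommGroup (M j)]
    [∀ j, Module R (M j)]
    (d : ∀ j, M j →ₗ[R] M (j + 1)) (h : ∀ j, M j →ₗ[R] M (j - 1)) (n : ℤ) :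
    Ttot M n →ₗ[R] Ttot M (n + 1) :=
  DirectSum.toModule R ℕ (Ttot M (n + 1)) (fun i =>
    ((DirectSum.lof R ℕ (fun i : ℕ => M (n + 1 + 2 * (i : ℤ))) i).comp
      ((lcast R M (show n + 2 * (i : ℤ) + 1 = n + 1 + 2 * (i : ℤ) by ring)).comp
        (d (n + 2 * (i : ℤ)))))
    +
    (match i with
     | 0 => 0
     | (k + 1) =>
        (DirectSum.lof R ℕ (fun i : ℕ => M (n + 1 + 2 * (i : ℤ))) k).comp
          ((lcast R M (show n + 2 * ((k + 1 : ℕ) : ℤ) - 1 = n + 1 + 2 * (k : ℤ) by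
              push_cast; ring)).comp
            (h (n + 2 * ((k + 1 : ℕ) : ℤ))))))

/-- The degree-one map `D = d + h` on the folded object `P`: out of the summand
`M^{n+2i}` it is the sum of `d` (landing in summand `i`) and `h` (landing in
summand `i - 1`). -/
noncomputable def DP (R : Type) [CommRing R] (M : ℤ → Type) [∀ j, AddCommGroup (M j)]
    [∀ j, Module R (M j)]
    (d : ∀ j, M j →ₗ[R] M (j + 1)) (h : ∀ j, M j →ₗ[R] M (j - 1)) (n : ℤ) :
    Ptot M n →ₗ[R] Ptot M (n + 1) :=
  DirectSum.toModule R ℤ (Ptot M (n + 1)) (fun i =>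
    ((DirectSum.lof R ℤ (fun i : ℤ => M (n + 1 + 2 * i)) i).comp
      ((lcast R M (show n + 2 * i + 1 = n + 1 + 2 * i by ring)).comp (d (n + 2 * i))))
    +
    ((DirectSum.lof R ℤ (fun i : ℤ => M (n + 1 + 2 * i)) (i - 1)).comp
      ((lcast R M (show n + 2 * i - 1 = n + 1 + 2 * (i - 1) by ring)).comp (h (n + 2 * i)))))

/-- The `n`-th cohomology of a `ℤ`-graded object equipped with degree-one maps
`D n : C^n → C^{n+1}`: the kernel of `D n` modulo the image of `D (n-1)`. -/
abbrev coh (R : Type) [CommRing R] {C : ℤ → Type} [∀ j, AddCommGroup (C j)]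
    [∀ j, Module R (C j)] (D : ∀ n, C n →ₗ[R] C (n + 1)) (n : ℤ) : Type :=
  ↥(LinearMap.ker (D n)) ⧸
    (Submodule.comap (LinearMap.ker (D n)).subtype
      (LinearMap.range ((lcast R C (show n - 1 + 1 = n by ring)).comp (D (n - 1)))))

theorem lcast_rfl (R : Type) [CommRing R] (C : ℤ → Type) [∀ j, AddCommGroup (C j)]
    [∀ j, Module R (C j)] {j : ℤ} (e : j = j) (x : C j) : lcast R C e x = x := rfl

theorem lcast_lcast (R : Type) [CommRing R] (C : ℤ → Type) [∀ j, AddCommGroup (C j)]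
    [∀ j, Module R (C j)] {j k l : ℤ} (e : j = k) (e' : k = l) (x : C j) :
    lcast R C e' (lcast R C e x) = lcast R C (e.trans e') x := by
  subst e; subst e'; rfl

section helpers

variable (R : Type) [CommRing R] (M : ℤ → Type) [∀ j, AddCommGroup (M j)]
    [∀ j, Module R (M j)]
    (d : ∀ j, M j →ₗ[R] M (j + 1)) (h : ∀ j, M j →ₗ[R] M (j - 1))

theorem d_lcast {j k : ℤ} (e : j = k) (x : M j) :
    d k (lcast R M e x) = lcast R M (by rw [e]) (d j x) := by
  subst e; rfl

theorem h_lcast {j k : ℤ} (e : j = k) (x : M j) :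
    h k (lcast R M e x) = lcast R M (by rw [e]) (h j x) := by
  subst e; rfl

theorem lofP_congr {n j i i' : ℤ} (hi : i = i') (e : j = n + 2 * i) (e' : j = n + 2 * i')
    (x : M j) :
    DirectSum.lof R ℤ (fun i : ℤ => M (n + 2 * i)) i (lcast R M e x) =
    DirectSum.lof R ℤ (fun i : ℤ => M (n + 2 * i)) i' (lcast R M e' x) := by
  subst hi; rfl

theorem lofT_congr {n j : ℤ} {i i' : ℕ} (hi : i = i') (e : j = n + 2 * (i : ℤ))
    (e' : j = n + 2 * (i' : ℤ)) (x : M j) :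
    DirectSum.lof R ℕ (fun i : ℕ => M (n + 2 * (i : ℤ))) i (lcast R M e x) =
    DirectSum.lof R ℕ (fun i : ℕ => M (n + 2 * (i : ℤ))) i' (lcast R M e' x) := by
  subst hi; rfl

theorem DP_lof (n i : ℤ) (x : M (n + 2 * i)) :
    DP R M d h n (DirectSum.lof R ℤ (fun i : ℤ => M (n + 2 * i)) i x) =
      DirectSum.lof R ℤ (fun i : ℤ => M (n + 1 + 2 * i)) i (lcast R M (by ring) (d _ x)) +
      DirectSum.lof R ℤ (fun i : ℤ => M (n + 1 + 2 * i)) (i - 1)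
        (lcast R M (by ring) (h _ x)) := by
  unfold DP
  rw [DirectSum.toModule_lof]
  rfl

theorem DT_lof_zero (n : ℤ) (x : M (n + 2 * ((0 : ℕ) : ℤ))) :
    DT R M d h n (DirectSum.lof R ℕ (fun i : ℕ => M (n + 2 * (i : ℤ))) 0 x) =
      DirectSum.lof R ℕ (fun i : ℕ => M (n + 1 + 2 * (i : ℤ))) 0
        (lcast R M (by ring) (d _ x)) := by
  unfold DT
  rw [DirectSum.toModule_lof]
  exact add_zero _

theorem DT_lof_succ (n : ℤ) (k : ℕ) (x : M (n + 2 * ((k + 1 : ℕ) : ℤ))) :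
    DT R M d h n (DirectSum.lof R ℕ (fun i : ℕ => M (n + 2 * (i : ℤ))) (k + 1) x) =
      DirectSum.lof R ℕ (fun i : ℕ => M (n + 1 + 2 * (i : ℤ))) (k + 1)
        (lcast R M (by ring) (d _ x)) +
      DirectSum.lof R ℕ (fun i : ℕ => M (n + 1 + 2 * (i : ℤ))) k
        (lcast R M (by push_cast; ring) (h _ x)) := by
  unfold DT
  rw [DirectSum.toModule_lof]
  rfl

/-- Reindexing map `P^n → P^{n+2k}`. -/
noncomputable def shiftP (k : ℤ) {n n' : ℤ} (e : n' = n + 2 * k) : Ptot M n →ₗ[R] Ptot M n' :=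
  DirectSum.toModule R ℤ (Ptot M n') (fun i =>
    (DirectSum.lof R ℤ (fun i : ℤ => M (n' + 2 * i)) (i - k)).comp
      (lcast R M (show n + 2 * i = n' + 2 * (i - k) by rw [e]; ring)))

theorem shiftP_lof (k : ℤ) {n n' : ℤ} (e : n' = n + 2 * k) (i : ℤ) (x : M (n + 2 * i)) :
    shiftP R M k e (DirectSum.lof R ℤ (fun i : ℤ => M (n + 2 * i)) i x) =
      DirectSum.lof R ℤ (fun i : ℤ => M (n' + 2 * i)) (i - k)
        (lcast R M (show n + 2 * i = n' + 2 * (i - k) by rw [e]; ring) x) := by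
  unfold shiftP
  rw [DirectSum.toModule_lof]
  rfl

theorem shiftP_shiftP (k l : ℤ) (hkl : k + l = 0) {n n' : ℤ} (e : n' = n + 2 * k)
    (e' : n = n' + 2 * l) :
    (shiftP R M l e').comp (shiftP R M k e) = LinearMap.id := by
  apply DirectSum.linearMap_ext
  intro i
  refine LinearMap.ext fun x => ?_
  simp only [LinearMap.comp_apply, LinearMap.id_apply]
  rw [shiftP_lof, shiftP_lof, lcast_lcast,
    lofP_congr R M (show i - k - l = i by omega) _ rfl, lcast_rfl]

/-- Reindexing equivalence. -/
noncomputable def shiftE (k : ℤ) {n n' : ℤ} (e : n' = n + 2 * k) : Ptot M n ≃ₗ[R] Ptot M n' :=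
  LinearEquiv.ofLinearMap (shiftP R M k e) (shiftP R M (-k) (show n = n' + 2 * (-k) by omega))
    (shiftP_shiftP R M _ _ (by omega) _ _) (shiftP_shiftP R M _ _ (by omega) _ _)

theorem shiftP_DP (k : ℤ) {n n' : ℤ} (e : n' = n + 2 * k) (e1 : n' + 1 = n + 1 + 2 * k)
    (y : Ptot M n) :
    shiftP R M k e1 (DP R M d h n y) = DP R M d h n' (shiftP R M k e y) := by
  suffices H : (shiftP R M k e1).comp (DP R M d h n) = (DP R M d h n').comp (shiftP R M k e) from
    LinearMap.congr_fun H y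
  apply DirectSum.linearMap_ext
  intro i
  refine LinearMap.ext fun x => ?_
  simp only [LinearMap.comp_apply]
  rw [DP_lof, map_add, shiftP_lof, shiftP_lof, shiftP_lof, DP_lof, d_lcast, h_lcast]
  simp only [lcast_lcast]
  refine congrArg₂ (· + ·) rfl ?_
  exact lofP_congr R M (show i - 1 - k = i - k - 1 by ring) _ _ _

theorem shiftP_lcast (k : ℤ) {n n' m m' : ℤ} (e : n' = n + 2 * k) (e1 : m' = m + 2 * k)
    (f : n = m) (f' : n' = m') (y : Ptot M n) :
    shiftP R M k e1 (lcast R (Ptot M) f y) = lcast R (Ptot M) f' (shiftP R M k e y) := by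
  subst f; subst f'; rfl

/-- Inclusion `T^n → P^n`. -/
noncomputable def incl (n : ℤ) : Ttot M n →ₗ[R] Ptot M n :=
  DirectSum.toModule R ℕ (Ptot M n) (fun i =>
    DirectSum.lof R ℤ (fun i : ℤ => M (n + 2 * i)) (i : ℤ))

theorem incl_lof (n : ℤ) (i : ℕ) (x : M (n + 2 * (i : ℤ))) :
    incl R M n (DirectSum.lof R ℕ (fun i : ℕ => M (n + 2 * (i : ℤ))) i x) =
      DirectSum.lof R ℤ (fun i : ℤ => M (n + 2 * i)) (i : ℤ) x := by
  unfold incl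
  rw [DirectSum.toModule_lof]

/-- Projection `P^n → T^n`. -/
noncomputable def proj (n : ℤ) : Ptot M n →ₗ[R] Ttot M n :=
  DirectSum.toModule R ℤ (Ttot M n) (fun i =>
    if hi : 0 ≤ i then
      (DirectSum.lof R ℕ (fun i : ℕ => M (n + 2 * (i : ℤ))) i.toNat).comp
        (lcast R M (show n + 2 * i = n + 2 * (i.toNat : ℤ) by omega))
    else 0)

theorem proj_lof (n i : ℤ) (hi : 0 ≤ i) (x : M (n + 2 * i)) :
    proj R M n (DirectSum.lof R ℤ (fun i : ℤ => M (n + 2 * i)) i x) =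
      DirectSum.lof R ℕ (fun i : ℕ => M (n + 2 * (i : ℤ))) i.toNat
        (lcast R M (show n + 2 * i = n + 2 * (i.toNat : ℤ) by omega) x) := by
  unfold proj
  rw [DirectSum.toModule_lof, dif_pos hi]
  rfl

theorem proj_incl (n : ℤ) : (proj R M n).comp (incl R M n) = LinearMap.id := by
  apply DirectSum.linearMap_ext
  intro i
  refine LinearMap.ext fun x => ?_
  simp only [LinearMap.comp_apply, LinearMap.id_apply]
  rw [incl_lof, proj_lof R M n i (by omega), lofT_congr R M (show (i : ℤ).toNat = i by omega) _ rfl,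
    lcast_rfl]

theorem incl_proj (a : ℤ) (hMa : ∀ j, j < a → Subsingleton (M j)) (n : ℤ) (hn : n ≤ a) :
    (incl R M n).comp (proj R M n) = LinearMap.id := by
  apply DirectSum.linearMap_ext
  intro i
  refine LinearMap.ext fun x => ?_
  simp only [LinearMap.comp_apply, LinearMap.id_apply]
  by_cases hi : 0 ≤ i
  · rw [proj_lof R M n i hi, incl_lof, lofP_congr R M (show (i.toNat : ℤ) = i by omega) _ rfl,
      lcast_rfl]
  · have := hMa (n + 2 * i) (by omega)
    rw [Subsingleton.elim x 0]
    simp only [map_zero]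

/-- `T^n ≃ P^n` in low degrees. -/
noncomputable def inclE (a : ℤ) (hMa : ∀ j, j < a → Subsingleton (M j)) (n : ℤ) (hn : n ≤ a) :
    Ttot M n ≃ₗ[R] Ptot M n :=
  LinearEquiv.ofLinearMap (incl R M n) (proj R M n) (incl_proj R M a hMa n hn) (proj_incl R M n)

theorem incl_DT (a : ℤ) (hMa : ∀ j, j < a → Subsingleton (M j)) (n : ℤ) (hn : n ≤ a)
    (y : Ttot M n) :
    incl R M (n + 1) (DT R M d h n y) = DP R M d h n (incl R M n y) := by
  suffices H : (incl R M (n + 1)).comp (DT R M d h n) = (DP R M d h n).comp (incl R M n) from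
    LinearMap.congr_fun H y
  apply DirectSum.linearMap_ext
  intro i
  refine LinearMap.ext fun x => ?_
  simp only [LinearMap.comp_apply]
  cases i with
  | zero =>
    rw [DT_lof_zero, incl_lof, incl_lof, DP_lof]
    have := hMa (n + 1 + 2 * (((0 : ℕ) : ℤ) - 1)) (by push_cast; omega)
    rw [Subsingleton.elim (lcast R M (show n + 2 * ((0 : ℕ) : ℤ) - 1 =
      n + 1 + 2 * (((0 : ℕ) : ℤ) - 1) by ring) (h _ x)) 0, map_zero]
    exact (add_zero _).symm
  | succ k =>
    rw [DT_lof_succ, map_add, incl_lof, incl_lof, incl_lof, DP_lof]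
    refine congrArg₂ (· + ·) rfl ?_
    exact lofP_congr R M (show (k : ℤ) = ((k + 1 : ℕ) : ℤ) - 1 by push_cast; ring) _ _ _

theorem incl_lcast {n m : ℤ} (f : n = m) (y : Ttot M n) :
    incl R M m (lcast R (Ttot M) f y) = lcast R (Ptot M) f (incl R M n y) := by
  subst f; rfl

end helpers

theorem coh_iso (R : Type) [CommRing R] {C C' : ℤ → Type} [∀ j, AddCommGroup (C j)]
    [∀ j, Module R (C j)] [∀ j, AddCommGroup (C' j)] [∀ j, Module R (C' j)]
    (D : ∀ n, C n →ₗ[R] C (n + 1)) (D' : ∀ n, C' n →ₗ[R] C' (n + 1)) (n n' : ℤ)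
    (eA : C (n - 1) ≃ₗ[R] C' (n' - 1)) (eB : C n ≃ₗ[R] C' n')
    (eC : C (n + 1) ≃ₗ[R] C' (n' + 1))
    (hBC : ∀ y, eC (D n y) = D' n' (eB y))
    (hAB : ∀ y, eB (lcast R C (show n - 1 + 1 = n by ring) (D (n - 1) y)) =
      lcast R C' (show n' - 1 + 1 = n' by ring) (D' (n' - 1) (eA y))) :
    Nonempty (coh R D n ≃ₗ[R] coh R D' n') := by
  have hker : (LinearMap.ker (D n)).map (eB : C n →ₗ[R] C' n') = LinearMap.ker (D' n') := by
    ext z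
    simp only [Submodule.mem_map, LinearMap.mem_ker]
    constructor
    · rintro ⟨y, hy, rfl⟩
      have := hBC y
      rw [hy, map_zero] at this
      exact this.symm
    · intro hz
      refine ⟨eB.symm z, ?_, eB.apply_symm_apply z⟩
      apply eC.injective
      rw [hBC, eB.apply_symm_apply, hz, map_zero]
  refine ⟨Submodule.Quotient.equiv _ _ (eB.ofSubmodules _ _ hker) ?_⟩
  ext z
  simp only [Submodule.mem_map, Submodule.mem_comap, LinearMap.mem_range]
  constructor
  · rintro ⟨y, ⟨w, hw⟩, rfl⟩
    refine ⟨eA w, ?_⟩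
    exact (hAB w).symm.trans (congrArg eB hw)
  · rintro ⟨w, hw⟩
    refine ⟨(eB.ofSubmodules _ _ hker).symm z, ⟨eA.symm w, ?_⟩, LinearEquiv.apply_symm_apply _ z⟩
    apply eB.injective
    refine (hAB _).trans ?_
    rw [eA.apply_symm_apply]
    refine hw.trans ?_
    exact (congrArg Subtype.val
      (LinearEquiv.apply_symm_apply (eB.ofSubmodules _ _ hker) z)).symm

theorem coh_shift (R : Type) [CommRing R] (M : ℤ → Type) [∀ j, AddCommGroup (M j)]
    [∀ j, Module R (M j)]
    (d : ∀ j, M j →ₗ[R] M (j + 1)) (h : ∀ j, M j →ₗ[R] M (j - 1)) (k n n' : ℤ)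
    (e : n' = n + 2 * k) :
    Nonempty (coh R (DP R M d h) n ≃ₗ[R] coh R (DP R M d h) n') := by
  refine coh_iso R _ _ n n' (shiftE R M k (by omega)) (shiftE R M k e)
    (shiftE R M k (by omega)) (fun y => shiftP_DP R M d h k e (by omega) y) (fun y => ?_)
  refine (shiftP_lcast R M k (show n' - 1 + 1 = n - 1 + 1 + 2 * k by omega) e _
    (by omega) _).trans ?_
  exact congrArg _ (shiftP_DP R M d h k (by omega) (by omega) y)

theorem coh_TP (R : Type) [CommRing R] (M : ℤ → Type) [∀ j, AddCommGroup (M j)]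
    [∀ j, Module R (M j)]
    (d : ∀ j, M j →ₗ[R] M (j + 1)) (h : ∀ j, M j →ₗ[R] M (j - 1)) (a : ℤ)
    (hMa : ∀ j, j < a → Subsingleton (M j)) (n : ℤ) (hn : n ≤ a - 1) :
    Nonempty (coh R (DT R M d h) n ≃ₗ[R] coh R (DP R M d h) n) := by
  refine coh_iso R _ _ n n (inclE R M a hMa _ (by omega)) (inclE R M a hMa _ (by omega))
    (inclE R M a hMa _ (by omega)) (fun y => incl_DT R M d h a hMa n (by omega) y) (fun y => ?_)
  refine (incl_lcast R M _ _).trans ?_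
  exact congrArg _ (incl_DT R M d h a hMa _ (by omega) y)

/-- For every integer `n ≤ a - 1` there is an isomorphism of
`R`-modules `H^n(T, D) ≅ H^n(P, D)`.  Moreover, since `P` is strictly two-periodic,
`H^n(P, D)` depends only on the parity of `n`; thus the stable values of the cohomology
of the totalization in large negative even (resp. odd) degrees are computed by `H^0`
(resp. `H^1`) of the folded two-periodic complex. -/
theorem cohomology_of_totalization_stably_computed_by_folded_complex
    (R : Type) [CommRing R] (a b : ℤ) (hab : a ≤ b)
    (M : ℤ → Type) [∀ j, AddCommGroup (M j)] [∀ j, Module R (M j)]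
    (d : ∀ j, M j →ₗ[R] M (j + 1)) (h : ∀ j, M j →ₗ[R] M (j - 1))
    (hMa : ∀ j, j < a → Subsingleton (M j))
    (hMb : ∀ j, b < j → Subsingleton (M j))
    (hdd : ∀ j, (d (j + 1)).comp (d j) = 0)
    (hhh : ∀ j, (h (j - 1)).comp (h j) = 0)
    (hdh : ∀ j,
      (lcast R M (show j - 1 + 1 = j by ring)).comp ((d (j - 1)).comp (h j))
        + (lcast R M (show j + 1 - 1 = j by ring)).comp ((h (j + 1)).comp (d j)) = 0) :
    (∀ n : ℤ, n ≤ a - 1 →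
      Nonempty (coh R (DT R M d h) n ≃ₗ[R] coh R (DP R M d h) n)) ∧
    (∀ n : ℤ, Nonempty (coh R (DP R M d h) n ≃ₗ[R] coh R (DP R M d h) (n + 2))) ∧
    (∀ n : ℤ, n ≤ a - 1 → Even n →
      Nonempty (coh R (DT R M d h) n ≃ₗ[R] coh R (DP R M d h) 0)) ∧
    (∀ n : ℤ, n ≤ a - 1 → Odd n →
      Nonempty (coh R (DT R M d h) n ≃ₗ[R] coh R (DP R M d h) 1)) := by
  refine ⟨fun n hn => coh_TP R M d h a hMa n hn, fun n => coh_shift R M d h 1 n _ (by ring),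
    fun n hn he => ?_, fun n hn ho => ?_⟩
  · obtain ⟨k, hk⟩ := he
    obtain ⟨e1⟩ := coh_TP R M d h a hMa n hn
    obtain ⟨e2⟩ := coh_shift R M d h (-k) n 0 (by omega)
    exact ⟨e1.trans e2⟩
  · obtain ⟨k, hk⟩ := ho
    obtain ⟨e1⟩ := coh_TP R M d h a hMa n hn
    obtain ⟨e2⟩ := coh_shift R M d h (-k) n 1 (by omega)
    exact ⟨e1.trans e2⟩
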